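/- arXiv:2110.00871 — 6 statements merged into one kernel-verified Lean document; each statement's English description precedes it below -/
import Mathlib

section
/- Let N ≥ 1 and let j_1, j_2, …, j_T be random variables with values in {1,…,N} such that for every t ≤ T, conditionally on the event {j_s ≠ 1 for all s < t}, the probability that j_t ≠ 1 equals 1 − 1/N. Then E[ Σ_{t=1}^T 0.5·1{j_t ≠ 1} ] ≥ 0.5·T·(1 − 1/N)^T. (This is the regret lower bound for standard Thompson Sampling on the paper's hard instance: there, regret 0.5 is incurred at each round where the sampled model index j_t differs from the true model index 1, and the posterior stays uniform on {1,…,N} until index 1 is sampled, so the sampled indices satisfy exactly the stated conditional uniformity.) -/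
open MeasureTheory

/-- If each of the first `T` rounds survives with conditional probability `c`, then the first `n`
rounds all survive with probability `c ^ n`. -/
theorem measure_forall_ne_one_eq_pow {Ω : Type*} [MeasurableSpace Ω] (μ : Measure Ω)
    [IsProbabilityMeasure μ] (c : ENNReal) (T : ℕ) (j : ℕ → Ω → ℕ)
    (hcond : ∀ t ∈ Finset.Icc 1 T,
      μ {ω | j t ω ≠ 1 ∧ ∀ s ∈ Finset.Ico 1 t, j s ω ≠ 1}
        = c * μ {ω | ∀ s ∈ Finset.Ico 1 t, j s ω ≠ 1})
    (n : ℕ) (hn : n ≤ T) :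
    μ {ω | ∀ s ∈ Finset.Icc 1 n, j s ω ≠ 1} = c ^ n := by
  induction n with
  | zero => simp
  | succ n ih =>
    have hIco : Finset.Ico 1 (n + 1) = Finset.Icc 1 n := by
      ext s
      simp only [Finset.mem_Ico, Finset.mem_Icc]
      omega
    have hsplit : {ω | ∀ s ∈ Finset.Icc 1 (n + 1), j s ω ≠ 1} =
        {ω | j (n + 1) ω ≠ 1 ∧ ∀ s ∈ Finset.Icc 1 n, j s ω ≠ 1} := by
      ext ω
      simp [← Finset.insert_Icc_right_eq_Icc_add_one]
    have h := hcond (n + 1) (Finset.mem_Icc.mpr ⟨by omega, hn⟩)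
    rw [hIco, ih (by omega)] at h
    rw [hsplit, h, pow_succ']

/-- Regret lower bound for standard Thompson Sampling on the hard instance:
`j t` is the index of the model sampled at round `t` (values in `{1,…,N}`, where
index `1` is the true model).  Conditionally on not having sampled the true model
before round `t`, the probability of again not sampling it is `1 − 1/N`.
The expected regret `E[Σ_{t=1}^T 0.5·1{j_t ≠ 1}]` is at least `0.5·T·(1 − 1/N)^T`. -/
theorem stmt_0 {Ω : Type*} [MeasurableSpace Ω] (μ : Measure Ω) [IsProbabilityMeasure μ]
    (N T : ℕ) (hN : 1 ≤ N)
    (j : ℕ → Ω → ℕ) (hjmeas : ∀ t, Measurable (j t))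
    (hjrange : ∀ t ω, j t ω ∈ Finset.Icc 1 N)
    (hcond : ∀ t ∈ Finset.Icc 1 T,
      μ {ω | j t ω ≠ 1 ∧ ∀ s ∈ Finset.Ico 1 t, j s ω ≠ 1}
        = ENNReal.ofReal (1 - 1 / (N : ℝ)) * μ {ω | ∀ s ∈ Finset.Ico 1 t, j s ω ≠ 1}) :
    0.5 * T * (1 - 1 / (N : ℝ)) ^ T ≤
      ∫ ω, (∑ t ∈ Finset.Icc 1 T, if j t ω ≠ 1 then (0.5 : ℝ) else 0) ∂μ := by
  have hc : (0 : ℝ) ≤ 1 - 1 / (N : ℝ) := by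
    have hN' : (1 : ℝ) ≤ N := by exact_mod_cast hN
    rw [sub_nonneg, div_le_one (by linarith)]
    exact hN'
  have hmeas : ∀ t, MeasurableSet {ω | j t ω ≠ 1} := fun t =>
    (hjmeas t (measurableSet_singleton 1)).compl
  set A : Set Ω := {ω | ∀ s ∈ Finset.Icc 1 T, j s ω ≠ 1} with hA
  have hAmeas : MeasurableSet A := by
    have hinter : A = ⋂ s ∈ Finset.Icc 1 T, {ω | j s ω ≠ 1} := by
      ext ω
      simp [hA]
    rw [hinter]
    exact Finset.measurableSet_biInter _ fun s _ => hmeas s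
  have hAprob : μ.real A = (1 - 1 / (N : ℝ)) ^ T := by
    rw [measureReal_def, hA, measure_forall_ne_one_eq_pow μ _ T j hcond T le_rfl,
      ENNReal.toReal_pow, ENNReal.toReal_ofReal hc]
  have hint : Integrable
      (fun ω => ∑ t ∈ Finset.Icc 1 T, if j t ω ≠ 1 then (0.5 : ℝ) else 0) μ :=
    integrable_finsetSum _ fun t _ =>
      ((integrable_const (0.5 : ℝ)).indicator (hmeas t)).congr
        (.of_forall fun ω => by simp [Set.indicator_apply])
  calc 0.5 * T * (1 - 1 / (N : ℝ)) ^ T = ∫ ω, A.indicator (fun _ => (0.5 * T : ℝ)) ω ∂μ := by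
        rw [integral_indicator_const _ hAmeas, hAprob, smul_eq_mul, mul_comm]
    _ ≤ _ := by
        refine integral_mono ((integrable_const _).indicator hAmeas) hint fun ω => ?_
        by_cases hω : ω ∈ A
        · have hsum : ∑ t ∈ Finset.Icc 1 T, (if j t ω ≠ 1 then (0.5 : ℝ) else 0) = 0.5 * T := by
            rw [Finset.sum_congr rfl fun t ht => if_pos (hω t ht)]
            simp [mul_comm]
          simp only [Set.indicator_of_mem hω, hsum, le_refl]
        · rw [Set.indicator_of_notMem hω]
          exact Finset.sum_nonneg fun t _ => by split_ifs <;> norm_num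
end

section
/- Let A be a finite set with |A| ≤ K, let (Ω, q) be a probability space, let a: Ω → A be measurable, let g: Ω × A → ℝ be bounded measurable and f_*: A → ℝ. For a' ∈ A set p_{a'} = q({θ : a(θ) = a'}). Then for every μ > 0: E_{θ∼q} |g(θ, a(θ)) − f_*(a(θ))| ≤ K/(4μ) + μ Σ_{a'∈A} p_{a'} E_{θ∼q} (g(θ,a') − f_*(a'))². In particular, in the contextual bandit setting with at most K actions at context x, the decoupling coefficient satisfies dc(x,b,Ω,B) ≤ K for every b ≥ 1. -/
open MeasureTheory

/-- A localized form of `2 x y ≤ x ^ 2 + y ^ 2`: the constant is integrated over `s` only. -/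
theorem setIntegral_abs_le_add_measureReal_mul_integral_sq {Ω : Type*} [MeasurableSpace Ω]
    (q : Measure Ω) [IsFiniteMeasure q] (s : Set Ω) {h : Ω → ℝ} (hi : Integrable h q)
    (hi2 : Integrable (fun θ => h θ ^ 2) q) {μ : ℝ} (hμ : 0 < μ) :
    ∫ θ in s, |h θ| ∂q ≤ 1 / (4 * μ) + μ * (q.real s * ∫ θ, h θ ^ 2 ∂q) := by
  have hint : 0 ≤ ∫ θ, h θ ^ 2 ∂q := integral_nonneg fun θ => sq_nonneg (h θ)
  rcases (measureReal_nonneg (μ := q) (s := s)).eq_or_lt with h0 | hpos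
  · have hs : q s = 0 := (measureReal_eq_zero_iff).1 h0.symm
    rw [setIntegral_measure_zero _ hs]
    positivity
  · set p := q.real s with hp
    have pointwise : ∀ θ, |h θ| ≤ 1 / (4 * μ * p) + μ * p * h θ ^ 2 := fun θ => by
      have hc : 0 < μ * p := by positivity
      have : 1 / (4 * μ * p) + μ * p * h θ ^ 2 - |h θ|
          = (2 * (μ * p) * |h θ| - 1) ^ 2 / (4 * (μ * p)) := by
        rw [← sq_abs (h θ)]
        field_simp
        ring
      have h2 : 0 ≤ (2 * (μ * p) * |h θ| - 1) ^ 2 / (4 * (μ * p)) := by positivity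
      linarith
    calc ∫ θ in s, |h θ| ∂q
        ≤ ∫ θ in s, (1 / (4 * μ * p) + μ * p * h θ ^ 2) ∂q :=
          integral_mono hi.abs.integrableOn
            ((integrable_const _).add (hi2.const_mul _).integrableOn) pointwise
      _ = 1 / (4 * μ) + μ * (p * ∫ θ in s, h θ ^ 2 ∂q) := by
          rw [integral_add (integrable_const _) (hi2.const_mul _).integrableOn,
            setIntegral_const, integral_const_mul, ← hp, smul_eq_mul]
          field_simp
      _ ≤ 1 / (4 * μ) + μ * (p * ∫ θ, h θ ^ 2 ∂q) := by
          gcongr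
          exacts [ae_of_all _ fun θ => sq_nonneg (h θ), Measure.restrict_le_self]

/-- Abstract decoupling lemma for a finite action set of cardinality at most `K`
(Lemma 1 of the paper): for a distribution `q` on parameters `θ`, a greedy action
map `a`, a (truncated) value function `g θ a'` and true values `fstar a'`, with
`p_{a'} = q {θ : a θ = a'}`, one has for every `μ > 0`:
`E_{θ∼q} |g(θ,a(θ)) − f_*(a(θ))| ≤ K/(4μ) + μ Σ_{a'} p_{a'} E_{θ∼q} (g(θ,a') − f_*(a'))²`.
In particular the decoupling coefficient `dc(x,b,Ω,B)` is at most `K` for every `b ≥ 1`. -/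
theorem stmt_1 {Ω : Type*} [MeasurableSpace Ω] (q : Measure Ω) [IsProbabilityMeasure q]
    {A : Type*} [Fintype A] [MeasurableSpace A] [MeasurableSingletonClass A]
    (K : ℕ) (hK : Fintype.card A ≤ K)
    (a : Ω → A) (ha : Measurable a)
    (g : Ω → A → ℝ) (hg : ∀ a' : A, Measurable fun θ => g θ a')
    (C : ℝ) (hgb : ∀ θ (a' : A), |g θ a'| ≤ C)
    (fstar : A → ℝ) (μ : ℝ) (hμ : 0 < μ) :
    ∫ θ, |g θ (a θ) - fstar (a θ)| ∂q ≤
      (K : ℝ) / (4 * μ) +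
        μ * ∑ a' : A, (q {θ | a θ = a'}).toReal * ∫ θ, (g θ a' - fstar a') ^ 2 ∂q := by
  classical
  have hE : ∀ a', MeasurableSet {θ | a θ = a'} := fun a' => ha (measurableSet_singleton a')
  have hmeas : ∀ a', Measurable fun θ => g θ a' - fstar a' := fun a' => (hg a').sub_const _
  have hbound : ∀ a' θ, |g θ a' - fstar a'| ≤ C + |fstar a'| := fun a' θ =>
    (abs_sub _ _).trans (by gcongr; exact hgb θ a')
  have hi : ∀ a', Integrable (fun θ => g θ a' - fstar a') q := fun a' =>
    .of_bound (hmeas a').aestronglyMeasurable _ (ae_of_all _ (hbound a'))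
  have hi2 : ∀ a', Integrable (fun θ => (g θ a' - fstar a') ^ 2) q := fun a' => by
    refine .of_bound ((hmeas a').pow_const 2).aestronglyMeasurable ((C + |fstar a'|) ^ 2)
      (ae_of_all _ fun θ => ?_)
    rw [Real.norm_eq_abs, abs_pow]
    gcongr
    exact hbound a' θ
  calc ∫ θ, |g θ (a θ) - fstar (a θ)| ∂q
      = ∫ θ, ∑ a', {θ | a θ = a'}.indicator (fun θ => |g θ a' - fstar a'|) θ ∂q := by
        simp [Set.indicator_apply]
    _ = ∑ a', ∫ θ in {θ | a θ = a'}, |g θ a' - fstar a'| ∂q := by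
        rw [integral_finsetSum _ fun a' _ => (hi a').abs.indicator (hE a')]
        simp_rw [integral_indicator (hE _)]
    _ ≤ ∑ a' : A, (1 / (4 * μ) +
          μ * ((q {θ | a θ = a'}).toReal * ∫ θ, (g θ a' - fstar a') ^ 2 ∂q)) :=
        Finset.sum_le_sum fun a' _ =>
          setIntegral_abs_le_add_measureReal_mul_integral_sq q _ (hi a') (hi2 a') hμ
    _ = (Fintype.card A : ℝ) / (4 * μ) +
          μ * ∑ a' : A, (q {θ | a θ = a'}).toReal * ∫ θ, (g θ a' - fstar a') ^ 2 ∂q := by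
        rw [Finset.sum_add_distrib, ← Finset.mul_sum, Finset.sum_const, Finset.card_univ,
          nsmul_eq_mul, mul_one_div]
    _ ≤ _ := by gcongr
end

section
/- Let (Ω, q) be a probability space, w: Ω → ℝ^K square-integrable measurable, w_* ∈ ℝ^K, A a measurable space, a: Ω → A measurable, and φ: A → ℝ^K bounded measurable. Then for every μ > 0: E_{θ∼q} |⟨w(θ)−w_*, φ(a(θ))⟩| ≤ K/(4μ) + μ · E_{θ'∼q} E_{θ∼q} ⟨w(θ)−w_*, φ(a(θ'))⟩². (This is the untruncated, b = ∞, case of the decoupling lemma for linearly embeddable contextual bandits: for f(θ,x,a)=w(θ,x)ᵀφ(x,a), f_*(x,a)=w_*(x)ᵀφ(x,a), the decoupling coefficient is at most the embedding dimension K.) -/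
open MeasureTheory

/-- A real symmetric matrix is diagonalized by an orthogonal matrix. -/
theorem exists_orthogonal_diagonalization {ι : Type*} [Fintype ι] [DecidableEq ι]
    (S : Matrix ι ι ℝ) (hS : S.IsHermitian) :
    ∃ (U : Matrix ι ι ℝ) (d : ι → ℝ), U * U.transpose = 1 ∧
      U.transpose * S * U = Matrix.diagonal d := by
  refine ⟨hS.eigenvectorUnitary, hS.eigenvalues, ?_, ?_⟩
  · have h := Unitary.mul_star_self_of_mem hS.eigenvectorUnitary.2
    rwa [Matrix.star_eq_conjTranspose, Matrix.conjTranspose_eq_transpose_of_trivial] at h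
  · have h := hS.conjStarAlgAut_star_eigenvectorUnitary
    rwa [Unitary.conjStarAlgAut_star_apply, Matrix.star_eq_conjTranspose,
      Matrix.conjTranspose_eq_transpose_of_trivial] at h

section

variable {Ω : Type*} [MeasurableSpace Ω] {q : Measure Ω}

/-- The one-dimensional decoupling inequality. -/
theorem integral_abs_mul_le_decoupled [IsProbabilityMeasure q] {v r : Ω → ℝ}
    (hv : MemLp v 2 q) (hr : MemLp r 2 q) {μ : ℝ} (hμ : 0 < μ) :
    ∫ θ, |v θ * r θ| ∂q ≤ 1 / (4 * μ) + μ * ((∫ θ, v θ ^ 2 ∂q) * ∫ θ, r θ ^ 2 ∂q) := by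
  set d := ∫ θ, v θ ^ 2 ∂q with hd
  have hd0 : 0 ≤ d := integral_nonneg fun θ => sq_nonneg _
  rcases hd0.eq_or_lt with h0 | hpos
  · have hv0 : (fun θ => v θ ^ 2) =ᵐ[q] 0 :=
      (integral_eq_zero_iff_of_nonneg (fun θ => sq_nonneg _) hv.integrable_sq).1 h0.symm
    have hz : ∫ θ, |v θ * r θ| ∂q = 0 := by
      refine integral_eq_zero_of_ae ?_
      filter_upwards [hv0] with θ hθ
      have : v θ = 0 := by simpa using hθ
      simp [this]
    rw [hz, ← h0]
    have : 0 < 1 / (4 * μ) := by positivity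
    linarith
  · have hpt : ∀ θ, |v θ * r θ| ≤ 1 / (4 * μ * d) * v θ ^ 2 + μ * d * r θ ^ 2 := by
      intro θ
      have hsq : 1 / (4 * μ * d) * v θ ^ 2 + μ * d * r θ ^ 2 - |v θ| * |r θ| =
          1 / (4 * μ * d) * (|v θ| - 2 * μ * d * |r θ|) ^ 2 := by
        rw [← sq_abs (v θ), ← sq_abs (r θ)]
        field_simp
        ring
      have : 0 ≤ 1 / (4 * μ * d) * (|v θ| - 2 * μ * d * |r θ|) ^ 2 := by positivity
      rw [abs_mul]
      linarith
    have hvi := hv.integrable_sq.const_mul (1 / (4 * μ * d))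
    have hri := hr.integrable_sq.const_mul (μ * d)
    calc ∫ θ, |v θ * r θ| ∂q
        ≤ ∫ θ, (1 / (4 * μ * d) * v θ ^ 2 + μ * d * r θ ^ 2) ∂q :=
          integral_mono (hv.integrable_mul hr).abs (hvi.add hri) hpt
      _ = 1 / (4 * μ * d) * d + μ * d * ∫ θ, r θ ^ 2 ∂q := by
          rw [integral_add hvi hri, integral_const_mul, integral_const_mul]
      _ = _ := by field_simp

/-- The second moment of a linear combination of square-integrable functions. -/
theorem integral_sum_mul_sq {ι : Type*} [Fintype ι] {v : ι → Ω → ℝ}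
    (hv : ∀ i, MemLp (v i) 2 q) (c : ι → ℝ) :
    ∫ θ, (∑ i, v i θ * c i) ^ 2 ∂q = ∑ i, ∑ j, c i * c j * ∫ θ, v i θ * v j θ ∂q := by
  have hint : ∀ i j, Integrable (fun θ => c i * c j * (v i θ * v j θ)) q := fun i j =>
    ((hv i).integrable_mul (hv j)).const_mul _
  calc ∫ θ, (∑ i, v i θ * c i) ^ 2 ∂q
      = ∫ θ, ∑ i, ∑ j, c i * c j * (v i θ * v j θ) ∂q := by
        congr 1 with θ
        rw [sq, Finset.sum_mul_sum]
        exact Finset.sum_congr rfl fun i _ => Finset.sum_congr rfl fun j _ => by ring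
    _ = _ := by
        rw [integral_finsetSum _ fun i _ => integrable_finsetSum _ fun j _ => hint i j]
        refine Finset.sum_congr rfl fun i _ => ?_
        rw [integral_finsetSum _ fun j _ => hint i j]
        simp only [integral_const_mul]

/-- The decoupling inequality for functions that are pairwise orthogonal in `L²`. -/
theorem integral_abs_sum_le_decoupled_of_orthogonal [IsProbabilityMeasure q]
    {ι : Type*} [Fintype ι] {v r : ι → Ω → ℝ}
    (hv : ∀ i, MemLp (v i) 2 q) (hr : ∀ i, MemLp (r i) 2 q)
    (horth : ∀ i j, i ≠ j → ∫ θ, v i θ * v j θ ∂q = 0) {μ : ℝ} (hμ : 0 < μ) :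
    ∫ θ, |∑ i, v i θ * r i θ| ∂q ≤
      (Fintype.card ι : ℝ) / (4 * μ) +
        μ * ∫ θ', ∫ θ, (∑ i, v i θ * r i θ') ^ 2 ∂q ∂q := by
  have hinner : ∀ θ', ∫ θ, (∑ i, v i θ * r i θ') ^ 2 ∂q =
      ∑ i, (∫ θ, v i θ ^ 2 ∂q) * r i θ' ^ 2 := by
    intro θ'
    rw [integral_sum_mul_sq hv]
    refine Finset.sum_congr rfl fun i _ => ?_
    rw [Finset.sum_eq_single i (fun j _ hj => by rw [horth i j hj.symm, mul_zero]) (by simp)]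
    simp only [← sq]
    ring
  have hvr : ∀ i, Integrable (fun θ => v i θ * r i θ) q := fun i => (hv i).integrable_mul (hr i)
  calc ∫ θ, |∑ i, v i θ * r i θ| ∂q
      ≤ ∫ θ, ∑ i, |v i θ * r i θ| ∂q :=
        integral_mono (integrable_finsetSum _ fun i _ => hvr i).abs
          (integrable_finsetSum _ fun i _ => (hvr i).abs)
          fun θ => Finset.abs_sum_le_sum_abs _ _
    _ = ∑ i, ∫ θ, |v i θ * r i θ| ∂q := integral_finsetSum _ fun i _ => (hvr i).abs
    _ ≤ ∑ i, (1 / (4 * μ) + μ * ((∫ θ, v i θ ^ 2 ∂q) * ∫ θ, r i θ ^ 2 ∂q)) :=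
        Finset.sum_le_sum fun i _ => integral_abs_mul_le_decoupled (hv i) (hr i) hμ
    _ = _ := by
        simp only [hinner]
        rw [integral_finsetSum _ fun i _ => (hr i).integrable_sq.const_mul _,
          Finset.sum_add_distrib, ← Finset.mul_sum]
        simp only [integral_const_mul, Finset.sum_const, Finset.card_univ, nsmul_eq_mul]
        ring

/-- The decoupling inequality for square-integrable functions. -/
theorem integral_abs_sum_le_decoupled [IsProbabilityMeasure q]
    {ι : Type*} [Fintype ι] {u p : ι → Ω → ℝ}
    (hu : ∀ i, MemLp (u i) 2 q) (hp : ∀ i, MemLp (p i) 2 q) {μ : ℝ} (hμ : 0 < μ) :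
    ∫ θ, |∑ i, u i θ * p i θ| ∂q ≤
      (Fintype.card ι : ℝ) / (4 * μ) +
        μ * ∫ θ', ∫ θ, (∑ i, u i θ * p i θ') ^ 2 ∂q ∂q := by
  classical
  let S : Matrix ι ι ℝ := Matrix.of fun i j => ∫ θ, u i θ * u j θ ∂q
  have hS : S.IsHermitian := by
    ext i j
    simp [S, mul_comm]
  obtain ⟨U, d, hU, hdiag⟩ := exists_orthogonal_diagonalization S hS
  have hrot : ∀ {f : ι → Ω → ℝ}, (∀ i, MemLp (f i) 2 q) →
      ∀ i, MemLp (fun θ => ∑ k, f k θ * U k i) 2 q := fun hf i =>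
    memLp_finsetSum _ fun k _ => (hf k).mul_const _
  have hdot : ∀ θ θ', ∑ i, (∑ k, u k θ * U k i) * (∑ l, p l θ' * U l i) =
      ∑ i, u i θ * p i θ' := by
    intro θ θ'
    have h := Matrix.dotProduct_mulVec (fun k => u k θ) (U * U.transpose) (fun k => p k θ')
    rw [hU, Matrix.one_mulVec, ← hU, ← Matrix.vecMul_vecMul, ← Matrix.dotProduct_mulVec,
      Matrix.mulVec_transpose] at h
    exact h.symm
  have horth : ∀ i j, i ≠ j →
      ∫ θ, (∑ k, u k θ * U k i) * (∑ l, u l θ * U l j) ∂q = 0 := by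
    intro i j hij
    have hint : ∀ k l, Integrable (fun θ => U k i * U l j * (u k θ * u l θ)) q := fun k l =>
      ((hu k).integrable_mul (hu l)).const_mul _
    calc ∫ θ, (∑ k, u k θ * U k i) * (∑ l, u l θ * U l j) ∂q
        = ∫ θ, ∑ k, ∑ l, U k i * U l j * (u k θ * u l θ) ∂q := by
          congr 1 with θ
          rw [Finset.sum_mul_sum]
          exact Finset.sum_congr rfl fun k _ => Finset.sum_congr rfl fun l _ => by ring
      _ = ∑ k, ∑ l, U k i * U l j * S k l := by
          rw [integral_finsetSum _ fun k _ => integrable_finsetSum _ fun l _ => hint k l]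
          refine Finset.sum_congr rfl fun k _ => ?_
          rw [integral_finsetSum _ fun l _ => hint k l]
          simp only [integral_const_mul, S, Matrix.of_apply]
      _ = (U.transpose * S * U) i j := by
          simp only [Matrix.mul_apply, Matrix.transpose_apply, Finset.sum_mul]
          rw [Finset.sum_comm]
          exact Finset.sum_congr rfl fun k _ => Finset.sum_congr rfl fun l _ => by ring
      _ = 0 := by rw [hdiag, Matrix.diagonal_apply_ne _ hij]
  simpa only [hdot] using
    integral_abs_sum_le_decoupled_of_orthogonal (hrot hu) (hrot hp) horth hμ

end

/-- Untruncated (`b = ∞`) decoupling lemma for linearly embeddable contextual bandits: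
for square-integrable `w : Ω → ℝ^K`, bounded `φ : A → ℝ^K` and measurable `a : Ω → A`,
for every `μ > 0`:
`E_{θ∼q} |⟨w(θ)−w_*, φ(a(θ))⟩| ≤ K/(4μ) + μ · E_{θ'∼q} E_{θ∼q} ⟨w(θ)−w_*, φ(a(θ'))⟩²`,
i.e. the decoupling coefficient is at most the embedding dimension `K`. -/
theorem stmt_3 {Ω A : Type*} [MeasurableSpace Ω] [MeasurableSpace A]
    (q : Measure Ω) [IsProbabilityMeasure q]
    (K : ℕ) (w : Ω → Fin K → ℝ) (wstar : Fin K → ℝ)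
    (a : Ω → A) (φ : A → Fin K → ℝ)
    (hwm : ∀ k, Measurable fun θ => w θ k)
    (hw2 : ∀ k, Integrable (fun θ => (w θ k) ^ 2) q)
    (ham : Measurable a) (hφm : ∀ k, Measurable fun y => φ y k)
    (C : ℝ) (hφb : ∀ y k, |φ y k| ≤ C)
    (μ : ℝ) (hμ : 0 < μ) :
    ∫ θ, |∑ k, (w θ k - wstar k) * φ (a θ) k| ∂q ≤
      (K : ℝ) / (4 * μ) +
        μ * ∫ θ', ∫ θ, (∑ k, (w θ k - wstar k) * φ (a θ') k) ^ 2 ∂q ∂q := by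
  have hu : ∀ k, MemLp (fun θ => w θ k - wstar k) 2 q := fun k =>
    ((memLp_two_iff_integrable_sq (hwm k).aestronglyMeasurable).2 (hw2 k)).sub (memLp_const _)
  have hp : ∀ k, MemLp (fun θ => φ (a θ) k) 2 q := fun k =>
    MemLp.of_bound ((hφm k).comp ham).aestronglyMeasurable C
      (Filter.Eventually.of_forall fun θ => hφb (a θ) k)
  simpa only [Fintype.card_fin] using integral_abs_sum_le_decoupled hu hp hμ
end

section
/- Let L be a nonnegative random variable with L ≤ c almost surely, where c ≥ 4, and let η > 0 satisfy ηc ≤ 1. Then E[ exp( −1.5(1 − 0.5η) η L ) ] ≤ 1 − 0.375 η E[L]. -/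
open MeasureTheory

/-- Second-order Taylor upper bound for `exp (-y)` with `y ≥ 0`. -/
theorem Real.exp_neg_le_one_sub_add_sq_div_two {y : ℝ} (hy : 0 ≤ y) :
    Real.exp (-y) ≤ 1 - y + y ^ 2 / 2 := by
  have h := Real.quadratic_le_exp_of_nonneg hy
  rw [Real.exp_neg, inv_le_iff_one_le_mul₀ (Real.exp_pos y)]
  have hpos : 0 ≤ 1 - y + y ^ 2 / 2 := by nlinarith [sq_nonneg (y - 1)]
  nlinarith [mul_le_mul_of_nonneg_left h hpos, sq_nonneg (y ^ 2)]

/-- Linear upper bound for `exp (-(a * x))` on the unit interval. -/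
theorem Real.exp_neg_mul_le_one_sub_mul {a x : ℝ} (ha : 1 ≤ a) (ha' : a ≤ 3 / 2)
    (hx : 0 ≤ x) (hx' : x ≤ 1) : Real.exp (-(a * x)) ≤ 1 - 3 / 8 * x := by
  have h := Real.exp_neg_le_one_sub_add_sq_div_two (y := a * x) (by positivity)
  have hxx : a ^ 2 * x ^ 2 ≤ a ^ 2 * x := by
    gcongr
    nlinarith
  have hq : 3 / 8 ≤ a - a ^ 2 / 2 := by nlinarith
  nlinarith [mul_le_mul_of_nonneg_right hq hx]

/-- Key moment estimate in the proof of the exponential-moment lemma: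
if `0 ≤ L ≤ c` a.s. with `c ≥ 4`, `η > 0` and `ηc ≤ 1`, then
`E[exp(−1.5(1 − 0.5η)η L)] ≤ 1 − 0.375 η E[L]`. -/
theorem stmt_10 {Ω : Type*} [MeasurableSpace Ω] (P : Measure Ω) [IsProbabilityMeasure P]
    (L : Ω → ℝ) (hL : Measurable L) (c : ℝ) (hc : 4 ≤ c)
    (hrange : ∀ᵐ ω ∂P, L ω ∈ Set.Icc 0 c)
    (η : ℝ) (hη : 0 < η) (hηc : η * c ≤ 1) :
    ∫ ω, Real.exp (-(1.5 * (1 - 0.5 * η) * η * L ω)) ∂P ≤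
      1 - 0.375 * η * ∫ ω, L ω ∂P := by
  have hint : Integrable L P :=
    Integrable.of_mem_Icc 0 c hL.aemeasurable hrange
  have hη' : η ≤ 1 / 4 := by nlinarith
  have hbound : ∀ᵐ ω ∂P, Real.exp (-(1.5 * (1 - 0.5 * η) * η * L ω)) ≤
      1 - 0.375 * η * L ω := by
    filter_upwards [hrange] with ω hω
    have h := Real.exp_neg_mul_le_one_sub_mul (a := 1.5 * (1 - 0.5 * η)) (x := η * L ω)
      (by linarith) (by linarith) (mul_nonneg hη.le hω.1)
      ((mul_le_mul_of_nonneg_left hω.2 hη.le).trans hηc)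
    rw [← mul_assoc] at h
    linarith
  calc
    _ ≤ ∫ ω, (1 - 0.375 * η * L ω) ∂P :=
      integral_mono_of_nonneg (Filter.Eventually.of_forall fun _ => (Real.exp_pos _).le)
        ((integrable_const _).sub (hint.const_mul _)) hbound
    _ = 1 - 0.375 * η * ∫ ω, L ω ∂P := by
      rw [integral_sub (integrable_const _) (hint.const_mul _), integral_const_mul]
      simp
end

section
/- In the deterministic-transition episodic contextual MDP Thompson Sampling setting, with range assumption (f^1(x^1) ∈ [0,Hb], per-step Bellman residuals in [−b,b]) and rewards r^h ∈ [0,1], if η · max(4, Hb²) ≤ 1 then ln E_{f̃∼p(·|S_{t−1})} E_{(x_t,a_t,r_t)∼p(·|f̃,x_t^1)} exp( − Σ_{h=0}^H ΔL^h(f̃, x_t, a_t, r_t) ) ≤ − 0.25 η E_{f̃∼p(·|S_{t−1})} Σ_{h=1}^H LS_t^h + λ E_{f_t∼p(·|S_{t−1})} FG_t + 1.5 λ² H² b². -/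
open MeasureTheory

/-- Hoeffding's lemma for a random variable centred at its mean. -/
lemma integral_exp_mul_sub_integral_le {Ω : Type*} [MeasurableSpace Ω] {μ : Measure Ω}
    [IsProbabilityMeasure μ] {X : Ω → ℝ} {a c : ℝ} (hX : AEMeasurable X μ)
    (hac : ∀ᵐ ω ∂μ, X ω ∈ Set.Icc a c) (t : ℝ) :
    ∫ ω, Real.exp (t * (X ω - ∫ ω, X ω ∂μ)) ∂μ ≤ Real.exp ((c - a) ^ 2 * t ^ 2 / 8) := by
  refine ((ProbabilityTheory.hasSubgaussianMGF_of_mem_Icc hX hac).mgf_le t).trans_eq ?_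
  congr 1
  push_cast
  rw [Real.norm_eq_abs, div_pow, sq_abs]
  ring

lemma exp_neg_le_one_sub_half {y : ℝ} (h0 : 0 ≤ y) (h1 : y ≤ 1) :
    Real.exp (-y) ≤ 1 - y / 2 := by
  have hq := Real.quadratic_le_exp_of_nonneg h0
  rw [Real.exp_neg, inv_le_iff_one_le_mul₀ (Real.exp_pos y)]
  nlinarith [mul_le_mul_of_nonneg_left hq (show (0 : ℝ) ≤ 1 - y / 2 by linarith),
    pow_le_one₀ h0 h1 (n := 2), mul_nonneg h0 (sub_nonneg.2 (pow_le_one₀ h0 h1 (n := 2)))]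

lemma integral_exp_neg_le {Ω : Type*} [MeasurableSpace Ω] {μ : Measure Ω}
    [IsProbabilityMeasure μ] {Y : Ω → ℝ} (hY : Measurable Y) (hY01 : ∀ ω, Y ω ∈ Set.Icc 0 1) :
    ∫ ω, Real.exp (-Y ω) ∂μ ≤ Real.exp (-(∫ ω, Y ω ∂μ) / 2) := by
  have hint : Integrable Y μ := Integrable.of_mem_Icc 0 1 hY.aemeasurable (ae_of_all _ hY01)
  calc ∫ ω, Real.exp (-Y ω) ∂μ ≤ ∫ ω, (1 - Y ω / 2) ∂μ := by
        refine integral_mono_of_nonneg (ae_of_all _ fun ω => (Real.exp_pos _).le)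
          ((integrable_const _).sub (hint.div_const 2))
          (ae_of_all _ fun ω => exp_neg_le_one_sub_half (hY01 ω).1 (hY01 ω).2)
    _ = -(∫ ω, Y ω ∂μ) / 2 + 1 := by
        rw [integral_sub (integrable_const _) (hint.div_const 2), integral_div]
        simp
        ring
    _ ≤ _ := Real.add_one_le_exp _

lemma integrable_exp_of_mem_Icc {Ω : Type*} [MeasurableSpace Ω] {μ : Measure Ω}
    [IsProbabilityMeasure μ] {X : Ω → ℝ} {a c : ℝ} (hX : Measurable X)
    (hac : ∀ ω, X ω ∈ Set.Icc a c) : Integrable (fun ω => Real.exp (X ω)) μ :=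
  Integrable.of_mem_Icc (Real.exp a) (Real.exp c) hX.exp.aemeasurable
    (ae_of_all _ fun ω => ⟨Real.exp_le_exp.2 (hac ω).1, Real.exp_le_exp.2 (hac ω).2⟩)

/-- A decoupled exponential moment bound: the two terms of the exponent are separated by the
inequality of arithmetic and geometric means. -/
lemma integral_exp_sub_half_le {Ω : Type*} [MeasurableSpace Ω] {μ : Measure Ω}
    [IsProbabilityMeasure μ] {X Y : Ω → ℝ} {a c : ℝ} (hX : Measurable X)
    (hac : ∀ ω, X ω ∈ Set.Icc a c) (hY : Measurable Y) (hY01 : ∀ ω, Y ω ∈ Set.Icc 0 1)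
    {t : ℝ} (ht : 0 ≤ t) :
    ∫ ω, Real.exp (t * X ω - Y ω / 2) ∂μ ≤
      Real.exp (t * ∫ ω, X ω ∂μ + (c - a) ^ 2 * t ^ 2 / 4 - (∫ ω, Y ω ∂μ) / 4) := by
  have hoeff := integral_exp_mul_sub_integral_le (μ := μ) hX.aemeasurable (ae_of_all _ hac) (2 * t)
  have hneg := integral_exp_neg_le (μ := μ) hY hY01
  set M := ∫ ω, X ω ∂μ
  set N := ∫ ω, Y ω ∂μ
  set K := (c - a) ^ 2 * t ^ 2 / 4
  have hintX : Integrable (fun ω => Real.exp (2 * t * (X ω - M))) μ := by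
    refine integrable_exp_of_mem_Icc (a := 2 * t * (a - M)) (c := 2 * t * (c - M))
      ((hX.sub_const M).const_mul _) fun ω => ⟨?_, ?_⟩
    · have := (hac ω).1
      gcongr
    · have := (hac ω).2
      gcongr
  have hintY : Integrable (fun ω => Real.exp (-Y ω)) μ :=
    integrable_exp_of_mem_Icc (a := -1) (c := 0) hY.neg
      fun ω => ⟨neg_le_neg (hY01 ω).2, neg_nonpos.2 (hY01 ω).1⟩
  have hpt : ∀ ω, Real.exp (t * X ω - Y ω / 2) ≤ Real.exp (t * M + K - N / 4) / 2 *
      (Real.exp (-(2 * K)) * Real.exp (2 * t * (X ω - M)) + Real.exp (N / 2) * Real.exp (-Y ω)) := by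
    intro ω
    have hsplit : Real.exp (t * X ω - Y ω / 2) = Real.exp (t * M + K - N / 4) *
        (Real.exp (t * (X ω - M) - K) * Real.exp (N / 4 - Y ω / 2)) := by
      rw [← Real.exp_add, ← Real.exp_add]
      ring_nf
    have hsqX : Real.exp (-(2 * K)) * Real.exp (2 * t * (X ω - M)) =
        Real.exp (t * (X ω - M) - K) ^ 2 := by
      rw [← Real.exp_add, ← Real.exp_nat_mul]
      push_cast
      ring_nf
    have hsqY : Real.exp (N / 2) * Real.exp (-Y ω) = Real.exp (N / 4 - Y ω / 2) ^ 2 := by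
      rw [← Real.exp_add, ← Real.exp_nat_mul]
      push_cast
      ring_nf
    rw [hsplit, hsqX, hsqY, div_mul_eq_mul_div, mul_div_assoc]
    gcongr
    linarith [two_mul_le_add_sq (Real.exp (t * (X ω - M) - K)) (Real.exp (N / 4 - Y ω / 2))]
  have hX1 : Real.exp (-(2 * K)) * ∫ ω, Real.exp (2 * t * (X ω - M)) ∂μ ≤ 1 := by
    calc _ ≤ Real.exp (-(2 * K)) * Real.exp ((c - a) ^ 2 * (2 * t) ^ 2 / 8) := by gcongr
      _ = 1 := by
        rw [← Real.exp_add, Real.exp_eq_one_iff]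
        ring
  have hY1 : Real.exp (N / 2) * ∫ ω, Real.exp (-Y ω) ∂μ ≤ 1 := by
    calc _ ≤ Real.exp (N / 2) * Real.exp (-N / 2) := by gcongr
      _ = 1 := by
        rw [← Real.exp_add, Real.exp_eq_one_iff]
        ring
  calc _ ≤ _ := integral_mono_of_nonneg (ae_of_all _ fun ω => (Real.exp_pos _).le)
        (((hintX.const_mul _).add (hintY.const_mul _)).const_mul _) (ae_of_all _ hpt)
    _ = Real.exp (t * M + K - N / 4) / 2 *
        (Real.exp (-(2 * K)) * ∫ ω, Real.exp (2 * t * (X ω - M)) ∂μ +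
          Real.exp (N / 2) * ∫ ω, Real.exp (-Y ω) ∂μ) := by
        rw [integral_const_mul, integral_add' (hintX.const_mul _) (hintY.const_mul _),
          integral_const_mul, integral_const_mul]
    _ ≤ Real.exp (t * M + K - N / 4) / 2 * (1 + 1) := by gcongr
    _ = _ := by ring

/-- For independent rewards, the exponential moment of the excess squared loss factorizes over
the steps. -/
lemma integral_pi_exp_sub_sum {ι : Type*} [Fintype ι] (ν : ι → Measure ℝ)
    [∀ i, IsProbabilityMeasure (ν i)] (A η : ℝ) (g e m : ι → ℝ) :
    ∫ r : ι → ℝ, Real.exp (A - ∑ i, η * ((g i - (r i + e i)) ^ 2 - (r i - m i) ^ 2))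
        ∂(Measure.pi ν) =
      Real.exp A * ∏ i, (Real.exp (-(η * (g i - (m i + e i)) ^ 2)) *
        ∫ r, Real.exp (2 * η * (g i - (m i + e i)) * (r - m i)) ∂(ν i)) := by
  simp_rw [← integral_const_mul]
  rw [← integral_fintype_prod_eq_prod, ← integral_const_mul]
  congr 1
  ext r
  simp_rw [← Real.exp_add]
  rw [← Real.exp_sum, ← Real.exp_add, sub_eq_add_neg, ← Finset.sum_neg_distrib]
  congr 3
  ext i
  ring

/-- Exponential-moment lemma for Thompson Sampling on deterministic-transition
episodic contextual MDPs (Lemma 6).  For `f̃ ∼ ρ` (the posterior), the greedy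
trajectory of `f̃` from `x¹` has deterministic state-action pairs; `g f h` is
`f̃^h` at its own step-`h` pair, `e f h = f̃^{h+1}(x^{h+1})`, `m f h` is the mean
reward there (so the Bellman residual is `g f h − (m f h + e f h) ∈ [−b,b]`),
`f1 f = f̃¹(x¹) ∈ [0,Hb]`, `V1 = V¹(x¹) ∈ [0,H]`, and rewards are independent
across steps with distributions `ν f h` supported in `[0,1]`.  If
`η · max(4, Hb²) ≤ 1` then
`ln E_{f̃∼ρ} E_{traj∼p(·|f̃,x¹)} exp(−Σ_{h=0}^H ΔL^h)
  ≤ −0.25η E_{f̃∼ρ} Σ_h LS_t^h + λ E_{f̃∼ρ} FG_t + 1.5λ²H²b²`. -/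
theorem stmt_16 {F : Type*} [MeasurableSpace F]
    (ρ : Measure F) [IsProbabilityMeasure ρ]
    (H : ℕ) (hH : 1 ≤ H)
    (b η lam : ℝ) (hb : 1 ≤ b) (hη : 0 < η)
    (hηc : η * max 4 ((H : ℝ) * b ^ 2) ≤ 1) (hlam : 0 ≤ lam)
    (g e m : F → Fin H → ℝ) (f1 : F → ℝ) (V1 : ℝ)
    (ν : F → Fin H → Measure ℝ) (hν : ∀ f h, IsProbabilityMeasure (ν f h))
    (hsupp : ∀ f h, ∀ᵐ r ∂(ν f h), r ∈ Set.Icc (0 : ℝ) 1)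
    (hmean : ∀ f h, ∫ r, r ∂(ν f h) = m f h)
    (hres : ∀ f h, g f h - (m f h + e f h) ∈ Set.Icc (-b) b)
    (hf1 : ∀ f, f1 f ∈ Set.Icc 0 ((H : ℝ) * b)) (hV1 : V1 ∈ Set.Icc 0 (H : ℝ))
    (hgm : ∀ h, Measurable fun f => g f h) (hem : ∀ h, Measurable fun f => e f h)
    (hmm : ∀ h, Measurable fun f => m f h) (hf1m : Measurable f1)
    (hinner : Measurable fun f => ∫ r : Fin H → ℝ,
        Real.exp (lam * (f1 f - V1)
          - ∑ h, η * ((g f h - (r h + e f h)) ^ 2 - (r h - m f h) ^ 2))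
        ∂(Measure.pi fun h => ν f h)) :
    Real.log (∫ f, (∫ r : Fin H → ℝ,
        Real.exp (lam * (f1 f - V1)
          - ∑ h, η * ((g f h - (r h + e f h)) ^ 2 - (r h - m f h) ^ 2))
        ∂(Measure.pi fun h => ν f h)) ∂ρ)
      ≤ -(0.25 * η) * ∫ f, (∑ h, (g f h - (m f h + e f h)) ^ 2) ∂ρ
        + lam * ∫ f, (f1 f - V1) ∂ρ
        + 1.5 * lam ^ 2 * (H : ℝ) ^ 2 * b ^ 2 := by
  have hη4 : η * 4 ≤ 1 := (mul_le_mul_of_nonneg_left (le_max_left _ _) hη.le).trans hηc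
  have hηH : η * (H * b ^ 2) ≤ 1 := (mul_le_mul_of_nonneg_left (le_max_right _ _) hη.le).trans hηc
  set G : F → ℝ := fun f => ∫ r : Fin H → ℝ,
    Real.exp (lam * (f1 f - V1)
      - ∑ h, η * ((g f h - (r h + e f h)) ^ 2 - (r h - m f h) ^ 2))
    ∂(Measure.pi fun h => ν f h)
  set Y : F → ℝ := fun f => η * ∑ h, (g f h - (m f h + e f h)) ^ 2 with hYdef
  have hG : ∀ f, G f = _ := fun f =>
    integral_pi_exp_sub_sum (ν f) (lam * (f1 f - V1)) η (g f) (e f) (m f)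
  have hGpos : ∀ f, 0 < G f := by
    intro f
    rw [hG f]
    refine mul_pos (Real.exp_pos _) (Finset.prod_pos fun h _ => mul_pos (Real.exp_pos _) ?_)
    rw [← hmean f h]
    exact integral_exp_pos ((ProbabilityTheory.hasSubgaussianMGF_of_mem_Icc aemeasurable_id
      (hsupp f h)).integrable_exp_mul _)
  have hGle : ∀ f, G f ≤ Real.exp (lam * (f1 f - V1) - Y f / 2) := by
    intro f
    rw [hG f, sub_eq_add_neg (lam * (f1 f - V1)), Real.exp_add]
    gcongr
    have hYsum : -(Y f / 2) = ∑ h, -(η * (g f h - (m f h + e f h)) ^ 2 / 2) := by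
      rw [Finset.sum_neg_distrib, ← Finset.sum_div, ← Finset.mul_sum]
    rw [hYsum, Real.exp_sum]
    refine Finset.prod_le_prod (fun h _ => mul_nonneg (Real.exp_pos _).le
      (integral_nonneg fun r => (Real.exp_pos _).le)) fun h _ => ?_
    have hoeff := integral_exp_mul_sub_integral_le (μ := ν f h) aemeasurable_id (hsupp f h)
      (2 * η * (g f h - (m f h + e f h)))
    simp only [id, hmean f h] at hoeff
    refine (mul_le_mul_of_nonneg_left hoeff (Real.exp_pos _).le).trans ?_
    rw [← Real.exp_add, Real.exp_le_exp]
    nlinarith [mul_nonneg (mul_nonneg hη.le (sq_nonneg (g f h - (m f h + e f h))))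
      (sub_nonneg.2 hη4)]
  have hYm : Measurable Y := by
    refine (Finset.measurable_sum _ fun h _ => ?_).const_mul η
    exact ((hgm h).sub ((hmm h).add (hem h))).pow_const 2
  have hY01 : ∀ f, Y f ∈ Set.Icc 0 1 := by
    refine fun f => ⟨mul_nonneg hη.le (Finset.sum_nonneg fun h _ => sq_nonneg _), ?_⟩
    refine le_trans (mul_le_mul_of_nonneg_left ?_ hη.le) hηH
    calc _ ≤ ∑ _h : Fin H, b ^ 2 :=
          Finset.sum_le_sum fun h _ => sq_le_sq' (hres f h).1 (hres f h).2
      _ = H * b ^ 2 := by simp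
  have hXm : Measurable fun f => f1 f - V1 := hf1m.sub_const V1
  have hX : ∀ f, f1 f - V1 ∈ Set.Icc (0 - V1) (H * b - V1) := fun f =>
    ⟨sub_le_sub_right (hf1 f).1 _, sub_le_sub_right (hf1 f).2 _⟩
  have hEint : Integrable (fun f => Real.exp (lam * (f1 f - V1) - Y f / 2)) ρ := by
    refine integrable_exp_of_mem_Icc (a := lam * (0 - V1) - 1 / 2)
      (c := lam * (H * b - V1) - 0 / 2) ((hXm.const_mul lam).sub (hYm.div_const 2))
      fun f => ⟨?_, ?_⟩
    · have := (hX f).1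
      have := (hY01 f).2
      gcongr
    · have := (hX f).2
      have := (hY01 f).1
      gcongr
  have hGint : Integrable G ρ := by
    refine hEint.mono' hinner.aestronglyMeasurable (ae_of_all _ fun f => ?_)
    rw [Real.norm_of_nonneg (hGpos f).le]
    exact hGle f
  have hpos : 0 < ∫ f, G f ∂ρ := by
    rw [integral_pos_iff_support_of_nonneg (fun f => (hGpos f).le) hGint,
      Function.support_eq_univ fun f => (hGpos f).ne', measure_univ]
    exact one_pos
  rw [Real.log_le_iff_le_exp hpos]
  refine (integral_mono hGint hEint hGle).trans
    ((integral_exp_sub_half_le hXm hX hYm hY01 hlam).trans ?_)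
  rw [Real.exp_le_exp, hYdef, integral_const_mul]
  nlinarith [sq_nonneg (lam * H * b)]
end

section
/- In the deterministic-transition episodic contextual MDP Thompson Sampling setting, with range assumption, rewards in [0,1], and η · max(4, Hb²) ≤ 1, define Z_t = E_{S_t} ln E_{f̃∼p_0} exp(−Σ_{s=1}^t Σ_{h=0}^H ΔL^h(f̃,x_s,a_s,r_s)) with Z_0 = 0. Then for each episode t: (0.25 η/λ) Σ_{h=1}^H E[LS_t^h] − E[FG_t] ≤ 1.5 λ H² b² + (Z_{t−1} − Z_t)/λ. -/
open MeasureTheory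

theorem integral_exp_mul_le_of_mem_Icc {Ω : Type*} [MeasurableSpace Ω] {μ : Measure Ω}
    [IsProbabilityMeasure μ] {X : Ω → ℝ} (hX : AEMeasurable X μ) {a c : ℝ}
    (hac : ∀ᵐ ω ∂μ, X ω ∈ Set.Icc a c) (s : ℝ) :
    ∫ ω, Real.exp (s * X ω) ∂μ ≤
      Real.exp (s * ∫ ω, X ω ∂μ + s ^ 2 * (c - a) ^ 2 / 8) := by
  have h := (ProbabilityTheory.hasSubgaussianMGF_of_mem_Icc hX hac).mgf_le s
  have hfac : ∫ ω, Real.exp (s * X ω) ∂μ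
      = Real.exp (s * ∫ ω, X ω ∂μ) * ProbabilityTheory.mgf (fun ω => X ω - ∫ ω', X ω' ∂μ) μ s := by
    rw [ProbabilityTheory.mgf, ← integral_const_mul]
    congr 1 with ω
    rw [← Real.exp_add]
    ring_nf
  rw [hfac, Real.exp_add]
  refine mul_le_mul_of_nonneg_left (h.trans (Real.exp_le_exp.2 (le_of_eq ?_)))
    (Real.exp_pos _).le
  rw [NNReal.coe_pow, NNReal.coe_div, coe_nnnorm, Real.norm_eq_abs, div_pow, sq_abs]
  push_cast
  ring

theorem integral_exp_sub_le {F : Type*} [MeasurableSpace F] {ρ : Measure F} {U Y : F → ℝ}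
    {α β : ℝ} (hU : Integrable (fun f => Real.exp (2 * U f)) ρ)
    (hY : Integrable (fun f => Real.exp (-2 * Y f)) ρ)
    (hα : ∫ f, Real.exp (2 * U f) ∂ρ ≤ Real.exp α)
    (hβ : ∫ f, Real.exp (-2 * Y f) ∂ρ ≤ Real.exp β) :
    ∫ f, Real.exp (U f - Y f) ∂ρ ≤ Real.exp ((α + β) / 2) := by
  have hpt (f : F) : Real.exp (U f - Y f) ≤
      Real.exp ((β - α) / 2) / 2 * Real.exp (2 * U f)
        + Real.exp ((α - β) / 2) / 2 * Real.exp (-2 * Y f) := by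
    have h1 : Real.exp ((β - α) / 2) * Real.exp (2 * U f)
        = Real.exp ((β - α) / 4 + U f) ^ 2 := by
      rw [← Real.exp_add, ← Real.exp_nat_mul]; push_cast; ring_nf
    have h2 : Real.exp ((α - β) / 2) * Real.exp (-2 * Y f)
        = Real.exp ((α - β) / 4 - Y f) ^ 2 := by
      rw [← Real.exp_add, ← Real.exp_nat_mul]; push_cast; ring_nf
    have h3 : Real.exp (U f - Y f)
        = Real.exp ((β - α) / 4 + U f) * Real.exp ((α - β) / 4 - Y f) := by
      rw [← Real.exp_add]; ring_nf
    rw [h3]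
    nlinarith [sq_nonneg (Real.exp ((β - α) / 4 + U f) - Real.exp ((α - β) / 4 - Y f))]
  calc ∫ f, Real.exp (U f - Y f) ∂ρ
      ≤ ∫ f, (Real.exp ((β - α) / 2) / 2 * Real.exp (2 * U f)
        + Real.exp ((α - β) / 2) / 2 * Real.exp (-2 * Y f)) ∂ρ :=
        integral_mono_of_nonneg (Filter.Eventually.of_forall fun f => (Real.exp_pos _).le)
          ((hU.const_mul _).add (hY.const_mul _)) (Filter.Eventually.of_forall hpt)
    _ = Real.exp ((β - α) / 2) / 2 * ∫ f, Real.exp (2 * U f) ∂ρ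
        + Real.exp ((α - β) / 2) / 2 * ∫ f, Real.exp (-2 * Y f) ∂ρ := by
        rw [integral_add (hU.const_mul _) (hY.const_mul _), integral_const_mul,
          integral_const_mul]
    _ ≤ Real.exp ((β - α) / 2) / 2 * Real.exp α
        + Real.exp ((α - β) / 2) / 2 * Real.exp β := by gcongr
    _ = Real.exp ((α + β) / 2) := by
        have h1 : Real.exp ((β - α) / 2) * Real.exp α = Real.exp ((α + β) / 2) := by
          rw [← Real.exp_add]; ring_nf
        have h2 : Real.exp ((α - β) / 2) * Real.exp β = Real.exp ((α + β) / 2) := by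
          rw [← Real.exp_add]; ring_nf
        linear_combination h1 / 2 + h2 / 2

theorem exp_neg_seven_fourths_mul_le {u : ℝ} (h0 : 0 ≤ u) (h1 : u ≤ 1) :
    Real.exp (-(7 / 4) * u) ≤ 1 - u / 2 := by
  have hc := convexOn_exp.2 (Set.mem_univ (0 : ℝ)) (Set.mem_univ (-(7 / 4) : ℝ))
    (sub_nonneg.2 h1) h0 (by ring)
  simp only [smul_eq_mul, mul_zero, zero_add, Real.exp_zero, mul_one] at hc
  have hhalf : Real.exp (-(7 / 4)) ≤ 1 / 2 := by
    rw [Real.exp_neg, ← one_div]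
    exact one_div_le_one_div_of_le two_pos (by linarith [Real.add_one_le_exp (7 / 4 : ℝ)])
  rw [mul_comm u] at hc
  nlinarith

theorem integral_exp_neg_mul_le {F : Type*} [MeasurableSpace F] {ρ : Measure F}
    [IsProbabilityMeasure ρ] {u : F → ℝ} (hu : Measurable u) (h01 : ∀ f, u f ∈ Set.Icc 0 1) :
    ∫ f, Real.exp (-(7 / 4) * u f) ∂ρ ≤ Real.exp (-(∫ f, u f ∂ρ) / 2) := by
  have hi : Integrable u ρ :=
    Integrable.of_mem_Icc 0 1 hu.aemeasurable (Filter.Eventually.of_forall h01)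
  calc ∫ f, Real.exp (-(7 / 4) * u f) ∂ρ ≤ ∫ f, (1 - u f / 2) ∂ρ :=
        integral_mono_of_nonneg (Filter.Eventually.of_forall fun f => (Real.exp_pos _).le)
          ((integrable_const _).sub (hi.div_const 2))
          (Filter.Eventually.of_forall fun f => exp_neg_seven_fourths_mul_le (h01 f).1 (h01 f).2)
    _ = -(∫ f, u f ∂ρ) / 2 + 1 := by
        rw [integral_sub (integrable_const _) (hi.div_const 2), integral_div]
        simp; ring
    _ ≤ _ := Real.add_one_le_exp _

theorem log_le_of_pos {y : ℝ} (hy : 0 < y) (B : ℝ) :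
    Real.log y ≤ Real.exp (-B) * y - 1 + B := by
  have h := Real.log_le_sub_one_of_pos (mul_pos (Real.exp_pos (-B)) hy)
  rw [Real.log_mul (Real.exp_pos _).ne' hy.ne', Real.log_exp] at h
  linarith

theorem integral_log_integral_exp_le {F R : Type*} [MeasurableSpace F] [MeasurableSpace R]
    {ρ : Measure F} [IsProbabilityMeasure ρ] {π : Measure R} [IsProbabilityMeasure π]
    {A : F → R → ℝ} (hA : Measurable (Function.uncurry A)) {K B : ℝ}
    (hK : ∀ᵐ r ∂π, ∀ f, A f r ≤ K)
    {c : ℝ} (hc : 0 < c) (hlog : Integrable (fun r => Real.log (c * ∫ f, Real.exp (A f r) ∂ρ)) π)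
    (hB : ∫ f, ∫ r, Real.exp (A f r) ∂π ∂ρ ≤ Real.exp B) :
    ∫ r, Real.log (c * ∫ f, Real.exp (A f r) ∂ρ) ∂π ≤ Real.log c + B := by
  have hint : Integrable (Function.uncurry fun f r => Real.exp (A f r)) (ρ.prod π) := by
    refine Integrable.of_bound (C := Real.exp K) hA.exp.aestronglyMeasurable ?_
    filter_upwards [Measure.quasiMeasurePreserving_snd.ae hK] with z hz
    simpa [Function.uncurry] using hz z.1
  have hpos : ∀ᵐ r ∂π, 0 < ∫ f, Real.exp (A f r) ∂ρ := by
    filter_upwards [hint.prod_left_ae] with r hr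
    exact integral_exp_pos hr
  have hI : Integrable (fun r => Real.exp (-B) * ∫ f, Real.exp (A f r) ∂ρ) π :=
    hint.integral_prod_right.const_mul _
  calc ∫ r, Real.log (c * ∫ f, Real.exp (A f r) ∂ρ) ∂π
      ≤ ∫ r, (Real.exp (-B) * (∫ f, Real.exp (A f r) ∂ρ) + (Real.log c - 1 + B)) ∂π := by
        refine integral_mono_ae hlog (hI.add (integrable_const _)) ?_
        filter_upwards [hpos] with r hr
        rw [Real.log_mul hc.ne' hr.ne']
        linarith [log_le_of_pos hr B]
    _ = Real.exp (-B) * (∫ f, ∫ r, Real.exp (A f r) ∂π ∂ρ) + (Real.log c - 1 + B) := by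
        rw [integral_add hI (integrable_const _), integral_const_mul,
          integral_integral_swap hint]
        simp
    _ ≤ Real.exp (-B) * Real.exp B + (Real.log c - 1 + B) := by gcongr
    _ = Real.log c + B := by rw [← Real.exp_add, neg_add_cancel, Real.exp_zero]; ring

theorem integral_pi_exp_neg_loss_le {ι : Type*} [Fintype ι] {ν : ι → Measure ℝ}
    [∀ h, IsProbabilityMeasure (ν h)] (hsupp : ∀ h, ∀ᵐ r ∂(ν h), r ∈ Set.Icc (0 : ℝ) 1)
    {m : ι → ℝ} (hmean : ∀ h, ∫ r, r ∂(ν h) = m h) {η : ℝ} (hη : 0 ≤ η) (hη4 : η ≤ 1 / 4)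
    (D : ℝ) (x : ι → ℝ) :
    ∫ r, Real.exp (D - ∑ h, η * ((x h - (r h - m h)) ^ 2 - (r h - m h) ^ 2)) ∂(Measure.pi ν)
      ≤ Real.exp (D - 7 / 8 * (η * ∑ h, x h ^ 2)) := by
  have hfac (r : ι → ℝ) :
      Real.exp (D - ∑ h, η * ((x h - (r h - m h)) ^ 2 - (r h - m h) ^ 2))
        = Real.exp D * ∏ h, (Real.exp (-η * x h ^ 2 - 2 * η * x h * m h)
          * Real.exp (2 * η * x h * r h)) := by
    simp_rw [← Real.exp_add]
    rw [← Real.exp_sum, ← Real.exp_add, sub_eq_add_neg, ← Finset.sum_neg_distrib]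
    congr 3 with h
    ring
  have hone (h : ι) : ∫ r, Real.exp (-η * x h ^ 2 - 2 * η * x h * m h)
      * Real.exp (2 * η * x h * r) ∂(ν h) ≤ Real.exp (-(7 / 8) * (η * x h ^ 2)) := by
    have hH := integral_exp_mul_le_of_mem_Icc aemeasurable_id (hsupp h) (2 * η * x h)
    simp only [id, hmean h] at hH
    rw [integral_const_mul]
    refine (mul_le_mul_of_nonneg_left hH (Real.exp_pos _).le).trans ?_
    rw [← Real.exp_add, Real.exp_le_exp]
    nlinarith [mul_nonneg (mul_nonneg hη (sq_nonneg (x h))) (sub_nonneg.2 hη4)]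
  simp_rw [hfac]
  rw [integral_const_mul, integral_fintype_prod_eq_prod
    (f := fun h r => Real.exp (-η * x h ^ 2 - 2 * η * x h * m h) * Real.exp (2 * η * x h * r))]
  refine (mul_le_mul_of_nonneg_left (Finset.prod_le_prod
    (fun h _ => integral_nonneg fun r => by positivity) fun h _ => hone h)
    (Real.exp_pos _).le).trans (le_of_eq ?_)
  rw [← Real.exp_sum, ← Real.exp_add, ← Finset.mul_sum, ← Finset.mul_sum]
  ring_nf

theorem integral_log_posterior_le {F ι : Type*} [MeasurableSpace F] [Fintype ι]
    {ρ : Measure F} [IsProbabilityMeasure ρ] {ν : ι → Measure ℝ}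
    [∀ h, IsProbabilityMeasure (ν h)] (hsupp : ∀ h, ∀ᵐ r ∂(ν h), r ∈ Set.Icc (0 : ℝ) 1)
    {m : ι → ℝ} (hmean : ∀ h, ∫ r, r ∂(ν h) = m h) {η lam b lo hi : ℝ} (hη : 0 ≤ η)
    (hη4 : η ≤ 1 / 4) (hηb : η * (Fintype.card ι * b ^ 2) ≤ 1) (hlam : 0 ≤ lam)
    {x : F → ι → ℝ} (hxm : ∀ h, Measurable fun f => x f h)
    (hx : ∀ f h, x f h ∈ Set.Icc (-b) b)
    {Δ : F → ℝ} (hΔm : Measurable Δ) (hΔ : ∀ f, Δ f ∈ Set.Icc lo hi)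
    {c : ℝ} (hc : 0 < c) (hlog : Integrable (fun r : ι → ℝ => Real.log (c * ∫ f, Real.exp (lam * Δ f
      - ∑ h, η * ((x f h - (r h - m h)) ^ 2 - (r h - m h) ^ 2)) ∂ρ)) (Measure.pi ν)) :
    ∫ r, Real.log (c * ∫ f, Real.exp (lam * Δ f
      - ∑ h, η * ((x f h - (r h - m h)) ^ 2 - (r h - m h) ^ 2)) ∂ρ) ∂(Measure.pi ν)
      ≤ Real.log c + (lam * (∫ f, Δ f ∂ρ) + lam ^ 2 * (hi - lo) ^ 2 / 4
        - η / 4 * ∫ f, ∑ h, x f h ^ 2 ∂ρ) := by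
  have hxsq (f : F) (h : ι) : x f h ^ 2 ≤ b ^ 2 := sq_le_sq' (hx f h).1 (hx f h).2
  have hS (f : F) : η * ∑ h, x f h ^ 2 ∈ Set.Icc (0 : ℝ) 1 := by
    refine ⟨by positivity, le_trans ?_ hηb⟩
    refine mul_le_mul_of_nonneg_left ?_ hη
    simpa using Finset.sum_le_sum fun h (_ : h ∈ Finset.univ) => hxsq f h
  have hSm : Measurable fun f => η * ∑ h, x f h ^ 2 := by fun_prop
  have hm1 (h : ι) : m h ∈ Set.Icc (0 : ℝ) 1 := by
    have hid : Integrable (fun r : ℝ => r) (ν h) :=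
      Integrable.of_mem_Icc 0 1 aemeasurable_id (hsupp h)
    rw [← hmean h]
    constructor
    · exact integral_nonneg_of_ae ((hsupp h).mono fun r hr => hr.1)
    · simpa using integral_mono_ae hid (integrable_const 1) ((hsupp h).mono fun r hr => hr.2)
  refine integral_log_integral_exp_le (K := lam * hi + ∑ _h : ι, η) ?_ ?_ hc hlog ?_
  · simp only [Function.uncurry_def]
    have hxm' (h : ι) : Measurable fun z : F × (ι → ℝ) => x z.1 h :=
      (hxm h).comp measurable_fst
    fun_prop
  · have hall : ∀ᵐ r ∂(Measure.pi ν), ∀ h, r h ∈ Set.Icc (0 : ℝ) 1 :=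
      ae_all_iff.2 fun h => (Measure.quasiMeasurePreserving_eval ν h).ae (hsupp h)
    filter_upwards [hall] with r hr f
    have h1 : lam * Δ f ≤ lam * hi := mul_le_mul_of_nonneg_left (hΔ f).2 hlam
    have h2 : -∑ h, η * ((x f h - (r h - m h)) ^ 2 - (r h - m h) ^ 2) ≤ ∑ _h : ι, η := by
      rw [← Finset.sum_neg_distrib]
      refine Finset.sum_le_sum fun h _ => ?_
      have h3 : (r h - m h) ^ 2 ≤ 1 := by
        rw [sq_le_one_iff_abs_le_one, abs_le]
        constructor <;> linarith [(hr h).1, (hr h).2, (hm1 h).1, (hm1 h).2]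
      nlinarith [mul_nonneg hη (sq_nonneg (x f h - (r h - m h))),
        mul_nonneg hη (sub_nonneg.2 h3)]
    linarith
  · have hbd (f : F) : Real.exp (lam * Δ f - 7 / 8 * (η * ∑ h, x f h ^ 2))
        ≤ Real.exp (lam * hi) := by
      rw [Real.exp_le_exp]
      linarith [mul_le_mul_of_nonneg_left (hΔ f).2 hlam, (hS f).1]
    have hint : Integrable
        (fun f => Real.exp (lam * Δ f - 7 / 8 * (η * ∑ h, x f h ^ 2))) ρ := by
      refine Integrable.of_bound (C := Real.exp (lam * hi))
        (Measurable.aestronglyMeasurable (by fun_prop)) ?_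
      filter_upwards with f
      simpa only [Real.norm_eq_abs, Real.abs_exp] using hbd f
    refine (integral_mono_of_nonneg
      (Filter.Eventually.of_forall fun f => integral_nonneg fun r => (Real.exp_pos _).le) hint
      (Filter.Eventually.of_forall fun f =>
        integral_pi_exp_neg_loss_le hsupp hmean hη hη4 (lam * Δ f) (x f))).trans ?_
    have hα := integral_exp_mul_le_of_mem_Icc hΔm.aemeasurable
      (Filter.Eventually.of_forall hΔ : ∀ᵐ f ∂ρ, _) (2 * lam)
    have hβ := integral_exp_neg_mul_le (ρ := ρ) hSm hS
    have hUi : Integrable (fun f => Real.exp (2 * lam * Δ f)) ρ :=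
      ProbabilityTheory.integrable_exp_mul_of_mem_Icc hΔm.aemeasurable
        (Filter.Eventually.of_forall hΔ)
    have hYi : Integrable (fun f => Real.exp (-(7 / 4) * (η * ∑ h, x f h ^ 2))) ρ :=
      ProbabilityTheory.integrable_exp_mul_of_mem_Icc hSm.aemeasurable
        (Filter.Eventually.of_forall hS)
    have hU (f : F) : 2 * lam * Δ f = 2 * (lam * Δ f) := by ring
    have hY (f : F) : -(7 / 4) * (η * ∑ h, x f h ^ 2)
        = -2 * (7 / 8 * (η * ∑ h, x f h ^ 2)) := by ring
    simp only [hU] at hα hUi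
    simp only [hY] at hβ hYi
    refine (integral_exp_sub_le hUi hYi hα hβ).trans (Real.exp_le_exp.2 (le_of_eq ?_))
    rw [integral_const_mul]
    ring

theorem integral_normalized_withDensity {F : Type*} [MeasurableSpace F] {p : Measure F}
    {w : F → ℝ} (hw0 : ∀ f, 0 ≤ w f) (hwm : Measurable w) {c : ℝ} (hc : 0 < c) (φ : F → ℝ) :
    ∫ f, φ f ∂((ENNReal.ofReal c)⁻¹ • p.withDensity fun f => ENNReal.ofReal (w f))
      = c⁻¹ * ∫ f, w f * φ f ∂p := by
  rw [integral_smul_measure, integral_withDensity_eq_integral_toReal_smul hwm.ennreal_ofReal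
    (by simp)]
  simp [ENNReal.toReal_ofReal, hw0, hc.le]

theorem isProbabilityMeasure_normalized_withDensity {F : Type*} [MeasurableSpace F]
    {p : Measure F} {w : F → ℝ} (hw0 : ∀ f, 0 ≤ w f) (hwi : Integrable w p)
    (hpos : 0 < ∫ f, w f ∂p) :
    IsProbabilityMeasure ((ENNReal.ofReal (∫ f, w f ∂p))⁻¹ •
      p.withDensity fun f => ENNReal.ofReal (w f)) := by
  constructor
  rw [Measure.smul_apply, withDensity_apply _ MeasurableSet.univ, Measure.restrict_univ,
    ← ofReal_integral_eq_lintegral_ofReal hwi (Filter.Eventually.of_forall hw0), smul_eq_mul]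
  exact ENNReal.inv_mul_cancel (by simpa using hpos) ENNReal.ofReal_ne_top

/-- One-step online-aggregation (potential) lemma for Thompson Sampling on
deterministic-transition episodic contextual MDPs (Lemma 7).  The probability
space `Ω` carries the randomness of `(S_{t−1}, f_t, x_t, a_t)` (the played
trajectory's states and actions are deterministic given `f_t` and `x_t¹`), while
the episode-`t` rewards `(r_t^1,…,r_t^H)` are independent across steps with
distributions `ν ω h` supported in `[0,1]` and means `m ω h`.
`W f ω = exp(−Σ_{s<t} Σ_{h=0}^H ΔL^h(f,x_s,a_s,r_s))` is the aggregation weight,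
`ρ ω` the posterior `p(·|S_{t−1})` (normalization of `W(·,ω)·p_0`);
`g f ω h = f^h(x_t^h,a_t^h)`, `e f ω h = f^{h+1}(x_t^{h+1})` along the played
trajectory, `f1 f ω = f¹(x_t¹)`, `V1 ω = V¹(x_t¹)`, and
`G f ω r = exp(−Σ_{h=0}^H ΔL^h(f,x_t,a_t,r))`.
With `Zprev = Z_{t−1}`, `Zcur = Z_t`, `LSe = Σ_h E[LS_t^h]`, `FGe = E[FG_t]`, if
`η·max(4,Hb²) ≤ 1` then
`(0.25η/λ) Σ_h E LS_t^h − E FG_t ≤ 1.5λH²b² + (Z_{t−1} − Z_t)/λ`. -/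
theorem stmt_17 {F Ω : Type*} [MeasurableSpace F] [MeasurableSpace Ω]
    (p0 : Measure F) [IsProbabilityMeasure p0]
    (P : Measure Ω) [IsProbabilityMeasure P]
    (H : ℕ) (hH : 1 ≤ H)
    (b η lam : ℝ) (hb : 1 ≤ b) (hη : 0 < η)
    (hηc : η * max 4 ((H : ℝ) * b ^ 2) ≤ 1) (hlam : 0 < lam)
    (g e : F → Ω → Fin H → ℝ) (m : Ω → Fin H → ℝ) (f1 : F → Ω → ℝ) (V1 : Ω → ℝ)
    (ν : Ω → Fin H → Measure ℝ) (hν : ∀ ω h, IsProbabilityMeasure (ν ω h))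
    (hsupp : ∀ ω h, ∀ᵐ r ∂(ν ω h), r ∈ Set.Icc (0 : ℝ) 1)
    (hmean : ∀ ω h, ∫ r, r ∂(ν ω h) = m ω h)
    (hres : ∀ f ω h, g f ω h - (m ω h + e f ω h) ∈ Set.Icc (-b) b)
    (hf1 : ∀ f ω, f1 f ω ∈ Set.Icc 0 ((H : ℝ) * b)) (hV1 : ∀ ω, V1 ω ∈ Set.Icc 0 (H : ℝ))
    (W : F → Ω → ℝ) (hWnn : ∀ f ω, 0 ≤ W f ω)
    (hWm : ∀ ω, Measurable fun f => W f ω)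
    (hWint : ∀ ω, Integrable (fun f => W f ω) p0)
    (hnorm : ∀ ω, 0 < ∫ f, W f ω ∂p0)
    (ρ : Ω → Measure F)
    (hρ : ∀ ω, ρ ω = (ENNReal.ofReal (∫ f, W f ω ∂p0))⁻¹ •
        p0.withDensity fun f => ENNReal.ofReal (W f ω))
    (hgm : ∀ ω h, Measurable fun f => g f ω h) (hem : ∀ ω h, Measurable fun f => e f ω h)
    (hf1m : ∀ ω, Measurable fun f => f1 f ω)
    (G : F → Ω → (Fin H → ℝ) → ℝ)
    (hG : ∀ f ω r, G f ω r = Real.exp (lam * (f1 f ω - V1 ω)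
        - ∑ h, η * ((g f ω h - (r h + e f ω h)) ^ 2 - (r h - m ω h) ^ 2)))
    (Zprev Zcur LSe FGe : ℝ)
    (hZprev : Zprev = ∫ ω, Real.log (∫ f, W f ω ∂p0) ∂P)
    (hZcur : Zcur = ∫ ω, ∫ r, Real.log (∫ f, W f ω * G f ω r ∂p0)
        ∂(Measure.pi fun h => ν ω h) ∂P)
    (hLSe : LSe = ∫ ω, ∫ f, (∑ h, (g f ω h - (m ω h + e f ω h)) ^ 2) ∂(ρ ω) ∂P)
    (hFGe : FGe = ∫ ω, ∫ f, (f1 f ω - V1 ω) ∂(ρ ω) ∂P)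
    (hZprevInt : Integrable (fun ω => Real.log (∫ f, W f ω ∂p0)) P)
    (hZcurInt : Integrable (fun ω => ∫ r, Real.log (∫ f, W f ω * G f ω r ∂p0)
        ∂(Measure.pi fun h => ν ω h)) P)
    (hlogInt : ∀ ω, Integrable (fun r => Real.log (∫ f, W f ω * G f ω r ∂p0))
        (Measure.pi fun h => ν ω h))
    (hLSeInt : Integrable
      (fun ω => ∫ f, (∑ h, (g f ω h - (m ω h + e f ω h)) ^ 2) ∂(ρ ω)) P)
    (hFGeInt : Integrable (fun ω => ∫ f, (f1 f ω - V1 ω) ∂(ρ ω)) P) :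
    0.25 * η / lam * LSe - FGe ≤
      1.5 * lam * (H : ℝ) ^ 2 * b ^ 2 + (Zprev - Zcur) / lam := by
  have hη4 : η ≤ 1 / 4 := by
    nlinarith [le_max_left (4 : ℝ) ((H : ℝ) * b ^ 2)]
  have hηb : η * (Fintype.card (Fin H) * b ^ 2) ≤ 1 := by
    rw [Fintype.card_fin]
    exact (mul_le_mul_of_nonneg_left (le_max_right _ _) hη.le).trans hηc
  have hkey (ω : Ω) : ∫ r, Real.log (∫ f, W f ω * G f ω r ∂p0) ∂(Measure.pi fun h => ν ω h)
      ≤ Real.log (∫ f, W f ω ∂p0) + lam * (∫ f, (f1 f ω - V1 ω) ∂(ρ ω))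
        + 1.5 * lam ^ 2 * (H : ℝ) ^ 2 * b ^ 2
        - η / 4 * ∫ f, (∑ h, (g f ω h - (m ω h + e f ω h)) ^ 2) ∂(ρ ω) := by
    have : ∀ h, IsProbabilityMeasure (ν ω h) := hν ω
    have hprob : IsProbabilityMeasure (ρ ω) := by
      rw [hρ]
      exact isProbabilityMeasure_normalized_withDensity (fun f => hWnn f ω) (hWint ω) (hnorm ω)
    have hWG (r : Fin H → ℝ) : ∫ f, W f ω * G f ω r ∂p0
        = (∫ f, W f ω ∂p0) * ∫ f, Real.exp (lam * (f1 f ω - V1 ω)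
          - ∑ h, η * ((g f ω h - (m ω h + e f ω h) - (r h - m ω h)) ^ 2
            - (r h - m ω h) ^ 2)) ∂(ρ ω) := by
      rw [hρ, integral_normalized_withDensity (fun f => hWnn f ω) (hWm ω) (hnorm ω),
        mul_inv_cancel_left₀ (hnorm ω).ne']
      simp only [hG]
      congr! 8 with f h
      ring
    have hlog := hlogInt ω
    simp only [hWG] at hlog ⊢
    have hΔ (f : F) : f1 f ω - V1 ω ∈ Set.Icc (-(H : ℝ)) ((H : ℝ) * b) :=
      ⟨by linarith [(hf1 f ω).1, (hV1 ω).2], by linarith [(hf1 f ω).2, (hV1 ω).1]⟩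
    refine (integral_log_posterior_le (hsupp ω) (hmean ω) hη.le hη4 hηb hlam.le
      (fun h => (hgm ω h).sub ((hem ω h).const_add _)) (fun f h => hres f ω h)
      ((hf1m ω).sub_const _) hΔ (hnorm ω) hlog).trans ?_
    have hrange : ((H : ℝ) * b - -(H : ℝ)) ^ 2 ≤ 4 * ((H : ℝ) ^ 2 * b ^ 2) := by
      have hHb : (H : ℝ) ≤ H * b := le_mul_of_one_le_right (Nat.cast_nonneg H) hb
      nlinarith [Nat.cast_nonneg (α := ℝ) H]
    have hlamHb : 0 ≤ lam ^ 2 * ((H : ℝ) ^ 2 * b ^ 2) := by positivity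
    simp only [Pi.sub_apply]
    linarith [mul_le_mul_of_nonneg_left hrange (sq_nonneg lam)]
  have hmain : Zcur ≤ Zprev + lam * FGe + 1.5 * lam ^ 2 * (H : ℝ) ^ 2 * b ^ 2
      - η / 4 * LSe := by
    have hRHS := ((hZprevInt.add (hFGeInt.const_mul lam)).add
      (integrable_const (1.5 * lam ^ 2 * (H : ℝ) ^ 2 * b ^ 2))).sub (hLSeInt.const_mul (η / 4))
    have h := integral_mono hZcurInt hRHS hkey
    simp only [Pi.add_apply, Pi.sub_apply] at h
    rw [integral_sub, integral_add, integral_add, integral_const_mul,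
      integral_const_mul (η / 4)] at h
    · simpa [hZcur, hZprev, hFGe, hLSe] using h
    · exact hZprevInt
    · exact hFGeInt.const_mul lam
    · exact hZprevInt.add (hFGeInt.const_mul lam)
    · exact integrable_const _
    · exact (hZprevInt.add (hFGeInt.const_mul lam)).add (integrable_const _)
    · exact hLSeInt.const_mul (η / 4)
  have hscale : 0.25 * η / lam * LSe - FGe
      - (1.5 * lam * (H : ℝ) ^ 2 * b ^ 2 + (Zprev - Zcur) / lam)
      = (Zcur - (Zprev + lam * FGe + 1.5 * lam ^ 2 * (H : ℝ) ^ 2 * b ^ 2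
        - η / 4 * LSe)) / lam := by
    field_simp
    ring
  have hquot := div_nonpos_of_nonpos_of_nonneg (sub_nonpos.2 hmain) hlam.le
  linarith
end
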